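/- arXiv:2505.06446 — 2 statements merged into one kernel-verified Lean document; each statement's English description precedes it below -/
import Mathlib

section
/- Let k ≥ 1 and let (f_y)_{y∈{−1,1}^k} be a collection of polymatroids on 2^{[k]}, with L the associated Lovász hinge. Then for every probability distribution p on {−1,1}^k there exists v ∈ {−1,0,1}^k such that L(v; p) = inf_{u ∈ ℝ^k} L(u; p); i.e., the finite set {−1,0,1}^k is representative for the Lovász hinge. -/
open Finset
open scoped Classical

noncomputable section

/-- The set `{π_1, …, π_i}` of the first `i` elements under the permutation `π`. -/
def chain (k : ℕ) (π : Equiv.Perm (Fin k)) (i : ℕ) : Finset (Fin k) :=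
  (Finset.univ.filter (fun j : Fin k => (j : ℕ) < i)).image π

/-- The Lovász extension of the set function `f`. -/
def lovaszExt (k : ℕ) (f : Finset (Fin k) → ℝ) (x : Fin k → ℝ) : ℝ :=
  Finset.univ.sup' ⟨1, Finset.mem_univ 1⟩
    (fun π : Equiv.Perm (Fin k) =>
      ∑ i : Fin k, x (π i) * (f (chain k π ((i : ℕ) + 1)) - f (chain k π (i : ℕ))))

/-- A polymatroid: normalized, increasing, submodular. -/
def IsPolymatroid (k : ℕ) (f : Finset (Fin k) → ℝ) : Prop :=
  f ∅ = 0 ∧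
  (∀ S T : Finset (Fin k), Disjoint S T → f S ≤ f (S ∪ T)) ∧
  (∀ S T : Finset (Fin k), f (S ∪ T) + f (S ∩ T) ≤ f S + f T)

def IsSign (k : ℕ) (y : Fin k → ℝ) : Prop := ∀ i, y i = 1 ∨ y i = -1

def IsV (k : ℕ) (v : Fin k → ℝ) : Prop := ∀ i, v i = -1 ∨ v i = 0 ∨ v i = 1

/-- The finite set of sign vectors `{-1,1}^k`. -/
def signVecs (k : ℕ) : Finset (Fin k → ℝ) :=
  Finset.image (fun s : Fin k → Bool => fun i => if s i then (1 : ℝ) else -1) Finset.univ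

def misSet (k : ℕ) (v y : Fin k → ℝ) : Finset (Fin k) :=
  Finset.univ.filter (fun i => v i ≠ y i)

def absSet (k : ℕ) (v : Fin k → ℝ) : Finset (Fin k) :=
  Finset.univ.filter (fun i => v i = 0)

/-- The Lovász hinge for a label-indexed collection of set functions. -/
def hinge (k : ℕ) (f : (Fin k → ℝ) → Finset (Fin k) → ℝ) (u y : Fin k → ℝ) : ℝ :=
  lovaszExt k (f y) (fun i => max (1 - u i * y i) 0)

def clip (k : ℕ) (u : Fin k → ℝ) : Fin k → ℝ := fun i => Real.sign (u i) * min |u i| 1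

def indVec (k : ℕ) (π : Equiv.Perm (Fin k)) (i : ℕ) : Fin k → ℝ :=
  fun j => if j ∈ chain k π i then 1 else 0

def Vpy (k : ℕ) (π : Equiv.Perm (Fin k)) (y : Fin k → ℝ) : Set (Fin k → ℝ) :=
  { x | ∃ i ≤ k, x = fun j => indVec k π i j * y j }

def Ppy (k : ℕ) (π : Equiv.Perm (Fin k)) (y : Fin k → ℝ) : Set (Fin k → ℝ) :=
  convexHull ℝ (Vpy k π y)

def psiHat (k : ℕ) (ε : ℝ) (u : Fin k → ℝ) : Set (Fin k → ℝ) :=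
  ⋂₀ { V : Set (Fin k → ℝ) |
      (∃ (π : Equiv.Perm (Fin k)) (y : Fin k → ℝ), IsSign k y ∧ V ⊆ Vpy k π y) ∧
      EMetric.infEdist (clip k u) (convexHull ℝ V) < ENNReal.ofReal ε }

def mval (k : ℕ) (ε : ℝ) (u : Fin k → ℝ) (π : Equiv.Perm (Fin k)) : ℕ → ℝ :=
  fun i => if i = 0 then 1 + ε
    else if h : i ≤ k ∧ 1 ≤ k then |u (π ⟨i - 1, by omega⟩)| else -ε
theorem mem_chain {k : ℕ} {π : Equiv.Perm (Fin k)} {i : ℕ} {j : Fin k} :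
    j ∈ chain k π i ↔ ((π.symm j : Fin k) : ℕ) < i := by
  simp only [chain, mem_image, mem_filter, mem_univ, true_and]
  constructor
  · rintro ⟨a, ha, rfl⟩
    simpa using ha
  · exact fun h => ⟨π.symm j, h, by simp⟩

theorem chain_zero (k : ℕ) (π : Equiv.Perm (Fin k)) : chain k π 0 = ∅ := by
  ext j; simp [mem_chain]

theorem chain_self (k : ℕ) (π : Equiv.Perm (Fin k)) : chain k π k = univ := by
  ext j; simp [mem_chain]

theorem chain_succ {k : ℕ} (π : Equiv.Perm (Fin k)) (i : Fin k) :
    chain k π ((i : ℕ) + 1) = insert (π i) (chain k π i) := by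
  ext j
  simp only [mem_chain, mem_insert, ← Equiv.symm_apply_eq, Fin.ext_iff]
  omega

theorem apply_notMem_chain {k : ℕ} (π : Equiv.Perm (Fin k)) (i : Fin k) :
    π i ∉ chain k π i := by
  simp [mem_chain]

theorem IsPolymatroid.marginal_nonneg {k : ℕ} {f : Finset (Fin k) → ℝ} (hf : IsPolymatroid k f)
    (π : Equiv.Perm (Fin k)) (i : Fin k) :
    0 ≤ f (chain k π ((i : ℕ) + 1)) - f (chain k π i) := by
  have h := hf.2.1 (chain k π i) {π i} (by simpa using apply_notMem_chain π i)
  rw [chain_succ, insert_eq, union_comm]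
  linarith

/-- The linear functional attached to the permutation `π` in the Lovász extension of `f`. -/
def permSum (k : ℕ) (f : Finset (Fin k) → ℝ) (π : Equiv.Perm (Fin k)) (x : Fin k → ℝ) : ℝ :=
  ∑ i : Fin k, x (π i) * (f (chain k π ((i : ℕ) + 1)) - f (chain k π (i : ℕ)))

theorem permSum_le_lovaszExt {k : ℕ} (f : Finset (Fin k) → ℝ) (π : Equiv.Perm (Fin k))
    (x : Fin k → ℝ) : permSum k f π x ≤ lovaszExt k f x :=
  Finset.le_sup' (permSum k f · x) (mem_univ π)

theorem lovaszExt_le {k : ℕ} {f : Finset (Fin k) → ℝ} {x : Fin k → ℝ} {c : ℝ}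
    (h : ∀ π, permSum k f π x ≤ c) : lovaszExt k f x ≤ c :=
  Finset.sup'_le _ _ fun π _ => h π

theorem IsPolymatroid.lovaszExt_mono {k : ℕ} {f : Finset (Fin k) → ℝ} (hf : IsPolymatroid k f)
    {x x' : Fin k → ℝ} (h : x ≤ x') : lovaszExt k f x ≤ lovaszExt k f x' :=
  lovaszExt_le fun π => le_trans
    (Finset.sum_le_sum fun i _ => mul_le_mul_of_nonneg_right (h _) (hf.marginal_nonneg π i))
    (permSum_le_lovaszExt f π x')

/-- The greedy vector of a permutation lies in the polymatroid polyhedron. -/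
theorem IsPolymatroid.sum_marginal_le {k : ℕ} {f : Finset (Fin k) → ℝ} (hf : IsPolymatroid k f)
    (σ : Equiv.Perm (Fin k)) (S : Finset (Fin k)) :
    ∑ j ∈ S, (f (chain k σ ((σ.symm j : ℕ) + 1)) - f (chain k σ (σ.symm j : ℕ))) ≤ f S := by
  have htel : ∑ i : Fin k, (f (S ∩ chain k σ ((i : ℕ) + 1)) - f (S ∩ chain k σ (i : ℕ))) = f S := by
    rw [← Finset.sum_range (fun i => f (S ∩ chain k σ (i + 1)) - f (S ∩ chain k σ i)),
      Finset.sum_range_sub (fun i => f (S ∩ chain k σ i)), chain_self, chain_zero]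
    simp [hf.1]
  have hsum : ∑ j ∈ S, (f (chain k σ ((σ.symm j : ℕ) + 1)) - f (chain k σ (σ.symm j : ℕ)))
      = ∑ i : Fin k, if σ i ∈ S then
          f (chain k σ ((i : ℕ) + 1)) - f (chain k σ (i : ℕ)) else 0 := by
    rw [← Equiv.sum_comp σ.symm]
    simp only [Equiv.apply_symm_apply, Finset.sum_ite_mem, Finset.univ_inter]
  rw [hsum, ← htel]
  refine Finset.sum_le_sum fun i _ => ?_
  split_ifs with hi
  · have h := hf.2.2 (chain k σ i) (S ∩ chain k σ ((i : ℕ) + 1))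
    have hU : chain k σ i ∪ S ∩ chain k σ ((i : ℕ) + 1) = chain k σ ((i : ℕ) + 1) := by
      rw [chain_succ]; ext j; simp only [mem_union, mem_inter, mem_insert]; grind
    have hI : chain k σ i ∩ (S ∩ chain k σ ((i : ℕ) + 1)) = S ∩ chain k σ i := by
      rw [chain_succ]; ext j; simp only [mem_inter, mem_insert]; tauto
    rw [hU, hI] at h
    linarith
  · rw [chain_succ, Finset.inter_insert_of_notMem hi, sub_self]

theorem mul_sum_range_le_sum_mul {n : ℕ} {a d : ℕ → ℝ}
    (ha : ∀ i < n, a (i + 1) ≤ a i) (hd : ∀ m ≤ n + 1, 0 ≤ ∑ i ∈ range m, d i) :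
    a n * ∑ i ∈ range (n + 1), d i ≤ ∑ i ∈ range (n + 1), a i * d i := by
  induction n with
  | zero => simp
  | succ n ih =>
    have h := ih (fun i hi => ha i (by omega)) (fun m hm => hd m (by omega))
    have h2 := mul_le_mul_of_nonneg_right (ha n (by omega)) (hd (n + 1) (by omega))
    rw [Finset.sum_range_succ _ (n + 1), Finset.sum_range_succ _ (n + 1), mul_add]
    linarith

/-- The greedy algorithm: the Lovász extension is attained at any permutation that sorts the
coordinates in decreasing order. -/
theorem IsPolymatroid.lovaszExt_eq_permSum {k : ℕ} {f : Finset (Fin k) → ℝ}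
    (hf : IsPolymatroid k f) {x : Fin k → ℝ} (hx : 0 ≤ x) {π : Equiv.Perm (Fin k)}
    (hπ : Antitone (x ∘ π)) : lovaszExt k f x = permSum k f π x := by
  refine le_antisymm (lovaszExt_le fun σ => ?_) (permSum_le_lovaszExt f π x)
  set w : Fin k → ℝ := fun j =>
    f (chain k σ ((σ.symm j : ℕ) + 1)) - f (chain k σ (σ.symm j : ℕ)) with hw
  have hσ : permSum k f σ x = ∑ i : Fin k, x (π i) * w (π i) := by
    rw [Equiv.sum_comp π (fun j => x j * w j), ← Equiv.sum_comp σ]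
    simp [permSum, hw]
  rw [← sub_nonneg, hσ, permSum, ← Finset.sum_sub_distrib]
  rcases k with _ | n
  · simp
  let a : ℕ → ℝ := fun i => if h : i < n + 1 then x (π ⟨i, h⟩) else 0
  let d : ℕ → ℝ := fun i => if h : i < n + 1 then
    f (chain (n + 1) π (i + 1)) - f (chain (n + 1) π i) - w (π ⟨i, h⟩) else 0
  have hd : ∀ m ≤ n + 1, 0 ≤ ∑ i ∈ range m, d i := by
    intro m hm
    have hsum : ∀ m ≤ n + 1,
        ∑ i ∈ range m, d i = f (chain (n + 1) π m) - ∑ j ∈ chain (n + 1) π m, w j := by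
      intro m
      induction m with
      | zero => simp [chain_zero, hf.1]
      | succ m ih =>
        intro hm
        have hlt : m < n + 1 := hm
        have hs := chain_succ π ⟨m, hlt⟩
        have hn := apply_notMem_chain π ⟨m, hlt⟩
        simp only at hs hn
        rw [Finset.sum_range_succ, ih hlt.le, hs, Finset.sum_insert hn, ← hs]
        simp only [d, dif_pos hlt]
        ring
    rw [hsum m hm, sub_nonneg]
    exact hf.sum_marginal_le σ _
  have hkey : a n * ∑ i ∈ range (n + 1), d i ≤ ∑ i ∈ range (n + 1), a i * d i := by
    refine mul_sum_range_le_sum_mul (fun i hi => ?_) hd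
    have h1 : i < n + 1 := by omega
    have h2 : i + 1 < n + 1 := by omega
    simp only [a, dif_pos h1, dif_pos h2]
    exact hπ (Fin.mk_le_mk.2 (Nat.le_succ i))
  have ha : 0 ≤ a n := by simpa [a] using hx _
  refine le_trans (mul_nonneg ha (hd _ le_rfl)) (hkey.trans_eq ?_)
  rw [Finset.sum_range]
  refine Finset.sum_congr rfl fun i _ => ?_
  simp only [a, d, dif_pos i.isLt, Fin.eta]
  ring

/-- The signed threshold `sign s * 1[t < |s|]` (for `0 ≤ t`). -/
def signedThreshold (t s : ℝ) : ℝ :=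
  (Set.Iio s).indicator (fun _ => (1 : ℝ)) t - (Set.Iio (-s)).indicator (fun _ => (1 : ℝ)) t

theorem signedThreshold_neg (t s : ℝ) : signedThreshold t (-s) = -signedThreshold t s := by
  simp [signedThreshold]

theorem signedThreshold_mem (t s : ℝ) :
    signedThreshold t s = -1 ∨ signedThreshold t s = 0 ∨ signedThreshold t s = 1 := by
  simp only [signedThreshold, Set.indicator_apply]
  split_ifs <;> simp

theorem signedThreshold_mono (t : ℝ) : Monotone (signedThreshold t) := by
  intro a b hab
  simp only [signedThreshold, Set.indicator_apply, Set.mem_Iio]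
  split_ifs <;> linarith

theorem integrableOn_indicator_Iio (s : ℝ) :
    MeasureTheory.IntegrableOn ((Set.Iio s).indicator (fun _ => (1 : ℝ))) (Set.Ico 0 1) :=
  MeasureTheory.Integrable.indicator (MeasureTheory.integrable_const 1) measurableSet_Iio

theorem integrableOn_signedThreshold (s : ℝ) :
    MeasureTheory.IntegrableOn (fun t => signedThreshold t s) (Set.Ico 0 1) :=
  (integrableOn_indicator_Iio s).sub (integrableOn_indicator_Iio (-s))

theorem integral_indicator_Iio {s : ℝ} (hs : s ≤ 1) :
    ∫ t in Set.Ico (0 : ℝ) 1, (Set.Iio s).indicator (fun _ => (1 : ℝ)) t = max s 0 := by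
  have hset : Set.Ico (0 : ℝ) 1 ∩ Set.Iio s = Set.Ico 0 s := by
    ext t
    simp only [Set.mem_inter_iff, Set.mem_Ico, Set.mem_Iio]
    exact ⟨fun h => ⟨h.1.1, h.2⟩, fun h => ⟨⟨h.1, h.2.trans_le hs⟩, h.2⟩⟩
  rw [MeasureTheory.setIntegral_indicator measurableSet_Iio, hset]
  simp

theorem integral_signedThreshold {s : ℝ} (h1 : -1 ≤ s) (h2 : s ≤ 1) :
    ∫ t in Set.Ico (0 : ℝ) 1, signedThreshold t s = s := by
  simp only [signedThreshold]
  rw [MeasureTheory.integral_sub (integrableOn_indicator_Iio s) (integrableOn_indicator_Iio (-s)),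
    integral_indicator_Iio h2, integral_indicator_Iio (by linarith)]
  rcases le_total s 0 with hs | hs
  · rw [max_eq_right hs, max_eq_left (by linarith)]; ring
  · rw [max_eq_left hs, max_eq_right (by linarith)]; ring

theorem integrableOn_permSum_signedThreshold {k : ℕ} (f : Finset (Fin k) → ℝ)
    (π : Equiv.Perm (Fin k)) (c y : Fin k → ℝ) :
    MeasureTheory.IntegrableOn
      (fun t => permSum k f π fun i => 1 - signedThreshold t (c i) * y i) (Set.Ico 0 1) :=
  MeasureTheory.integrable_finsetSum _ fun i _ =>
    ((MeasureTheory.integrable_const 1).sub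
      ((integrableOn_signedThreshold (c (π i))).mul_const (y (π i)))).mul_const _

theorem integral_permSum_signedThreshold {k : ℕ} (f : Finset (Fin k) → ℝ)
    (π : Equiv.Perm (Fin k)) {c : Fin k → ℝ} (hc1 : ∀ i, -1 ≤ c i) (hc2 : ∀ i, c i ≤ 1)
    (y : Fin k → ℝ) :
    ∫ t in Set.Ico (0 : ℝ) 1, permSum k f π (fun i => 1 - signedThreshold t (c i) * y i)
      = permSum k f π (fun i => 1 - c i * y i) := by
  have hint (i : Fin k) := (integrableOn_signedThreshold (c (π i))).mul_const (y (π i))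
  have hone : MeasureTheory.IntegrableOn (fun _ : ℝ => (1 : ℝ)) (Set.Ico 0 1) :=
    MeasureTheory.integrable_const 1
  have hterm (i : Fin k) (m : ℝ) : MeasureTheory.IntegrableOn
      (fun t => (1 - signedThreshold t (c (π i)) * y (π i)) * m) (Set.Ico 0 1) :=
    (hone.sub (hint i)).mul_const m
  simp only [permSum]
  rw [MeasureTheory.integral_finsetSum _ fun i _ => hterm i _]
  refine Finset.sum_congr rfl fun i _ => ?_
  rw [MeasureTheory.integral_mul_const, MeasureTheory.integral_sub hone (hint i),
    MeasureTheory.integral_mul_const, integral_signedThreshold (hc1 _) (hc2 _)]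
  simp

theorem isSign_of_mem_signVecs {k : ℕ} {y : Fin k → ℝ} (hy : y ∈ signVecs k) : IsSign k y := by
  obtain ⟨s, -, rfl⟩ := Finset.mem_image.1 hy
  intro i
  by_cases h : s i <;> simp [h]

theorem hinge_eq_of_mul_le_one {k : ℕ} (f : (Fin k → ℝ) → Finset (Fin k) → ℝ) {u y : Fin k → ℝ}
    (h : ∀ i, u i * y i ≤ 1) : hinge k f u y = lovaszExt k (f y) (fun i => 1 - u i * y i) := by
  unfold hinge
  congr 1
  funext i
  exact max_eq_left (sub_nonneg.2 (h i))

theorem finite_setOf_isV (k : ℕ) : {v : Fin k → ℝ | IsV k v}.Finite := by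
  refine (Set.Finite.pi' (t := fun _ : Fin k => ({-1, 0, 1} : Set ℝ))
    fun _ => Set.toFinite _).subset ?_
  intro v hv i
  simpa using hv i

/-- `{-1,0,1}^k` is representative for the Lovász hinge: for every
distribution `p` on `{-1,1}^k`, some `v ∈ {-1,0,1}^k` attains the infimum of the expected
Lovász hinge over all of `ℝ^k`. -/
theorem V_representative_for_lovasz_hinge
    (k : ℕ) (hk : 1 ≤ k) (f : (Fin k → ℝ) → Finset (Fin k) → ℝ)
    (hf : ∀ y : Fin k → ℝ, IsSign k y → IsPolymatroid k (f y))
    (p : (Fin k → ℝ) → ℝ) (hp0 : ∀ y ∈ signVecs k, 0 ≤ p y)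
    (hp1 : ∑ y ∈ signVecs k, p y = 1) :
    ∃ v : Fin k → ℝ, IsV k v ∧ ∀ u : Fin k → ℝ,
      ∑ y ∈ signVecs k, p y * hinge k f v y ≤ ∑ y ∈ signVecs k, p y * hinge k f u y := by
  obtain ⟨v, hv, hmin⟩ := Set.exists_min_image {v : Fin k → ℝ | IsV k v}
    (fun v => ∑ y ∈ signVecs k, p y * hinge k f v y) (finite_setOf_isV k)
    ⟨fun _ => 0, fun _ => Or.inr (Or.inl rfl)⟩
  refine ⟨v, hv, fun u => ?_⟩
  let c : Fin k → ℝ := fun i => max (-1) (min 1 (u i))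
  have hc1 : ∀ i, -1 ≤ c i := fun i => le_max_left _ _
  have hc2 : ∀ i, c i ≤ 1 := fun i => max_le (by norm_num) (min_le_left _ _)
  have hsort (y : Fin k → ℝ) : ∃ π : Equiv.Perm (Fin k), Monotone ((fun i => c i * y i) ∘ π) :=
    ⟨_, Tuple.monotone_sort _⟩
  choose π hπ using hsort
  have hthr (t : ℝ) : ∀ y ∈ signVecs k, hinge k f (fun i => signedThreshold t (c i)) y
      = permSum k (f y) (π y) (fun i => 1 - signedThreshold t (c i) * y i) := by
    intro y hy
    have hs := isSign_of_mem_signVecs hy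
    have hmul (i : Fin k) : signedThreshold t (c i) * y i = signedThreshold t (c i * y i) := by
      rcases hs i with h | h <;> simp [h, signedThreshold_neg]
    have hle (i : Fin k) : signedThreshold t (c i) * y i ≤ 1 := by
      rw [hmul]
      rcases signedThreshold_mem t (c i * y i) with h | h | h <;> rw [h] <;> norm_num
    rw [hinge_eq_of_mul_le_one f hle]
    refine (hf y hs).lovaszExt_eq_permSum (fun i => sub_nonneg.2 (hle i)) fun i j hij => ?_
    simp only [Function.comp_apply, hmul]
    exact sub_le_sub_left (signedThreshold_mono t (hπ y hij)) 1
  have hlow (t : ℝ) : ∑ y ∈ signVecs k, p y * hinge k f v y ≤ ∑ y ∈ signVecs k,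
      p y * permSum k (f y) (π y) (fun i => 1 - signedThreshold t (c i) * y i) :=
    (hmin (fun i => signedThreshold t (c i)) fun i => signedThreshold_mem t (c i)).trans_eq
      (Finset.sum_congr rfl fun y hy => by rw [hthr t y hy])
  have hint (y : Fin k → ℝ) :=
    (integrableOn_permSum_signedThreshold (f y) (π y) c y).const_mul (p y)
  have hconst : MeasureTheory.IntegrableOn
      (fun _ : ℝ => ∑ y ∈ signVecs k, p y * hinge k f v y) (Set.Ico 0 1) :=
    MeasureTheory.integrable_const _
  calc ∑ y ∈ signVecs k, p y * hinge k f v y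
      = ∫ _ in Set.Ico (0 : ℝ) 1, ∑ y ∈ signVecs k, p y * hinge k f v y := by simp
    _ ≤ ∫ t in Set.Ico (0 : ℝ) 1, ∑ y ∈ signVecs k,
          p y * permSum k (f y) (π y) (fun i => 1 - signedThreshold t (c i) * y i) :=
        MeasureTheory.integral_mono hconst
          (MeasureTheory.integrable_finsetSum _ fun y _ => hint y) hlow
    _ = ∑ y ∈ signVecs k, p y * permSum k (f y) (π y) (fun i => 1 - c i * y i) := by
        rw [MeasureTheory.integral_finsetSum _ fun y _ => hint y]
        simp only [MeasureTheory.integral_const_mul,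
          integral_permSum_signedThreshold _ _ hc1 hc2]
    _ ≤ ∑ y ∈ signVecs k, p y * hinge k f u y := by
        refine Finset.sum_le_sum fun y hy => mul_le_mul_of_nonneg_left ?_ (hp0 y hy)
        have hs := isSign_of_mem_signVecs hy
        refine (permSum_le_lovaszExt _ _ _).trans ((hf y hs).lovaszExt_mono fun i => ?_)
        simp only [c]
        rcases hs i with h | h <;> rw [h] <;> grind

end
end

section
/- Let k ≥ 3 and let (f_y)_{y∈{−1,1}^k} be a collection of polymatroids on 2^{[k]} satisfying Condition 1. Let p̄ be the uniform distribution on {−1,1}^k. Then the all-zeros vector 0⃗ minimizes ℓ_abs(·; p̄) over {−1,0,1}^k, and every minimizer of ℓ_abs(·; p̄) over {−1,0,1}^k lies in {0⃗, 1⃗} (where 1⃗ is the all-ones vector). -/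
open Finset
open scoped Classical

noncomputable section

/-- `χ_S ∈ {-1,1}^k`: `1` on `S`, `-1` off `S`. -/
def chiS (k : ℕ) (S : Finset (Fin k)) : Fin k → ℝ := fun i => if i ∈ S then 1 else -1

/-- Condition 1 on a collection of set functions. -/
def Condition1 (k : ℕ) (f : (Fin k → ℝ) → Finset (Fin k) → ℝ) : Prop :=
  ∀ y : Fin k → ℝ, IsSign k y →
    f y ∅ < f y Finset.univ ∧
    ∀ S : Finset (Fin k),
      f y Finset.univ ≤ f y S + f (fun i => -y i) Sᶜ ∧
      (S ≠ ∅ → S ≠ Finset.univ → y ≠ (fun _ => -1) → y ≠ (fun i => -(chiS k S i)) →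
        y ≠ (fun _ => 1) → f y Finset.univ < f y S + f (fun i => -y i) Sᶜ)

lemma mem_signVecs {k : ℕ} {y : Fin k → ℝ} : y ∈ signVecs k ↔ IsSign k y := by
  simp only [signVecs, mem_image, mem_univ, true_and]
  constructor
  · rintro ⟨s, rfl⟩ i
    by_cases h : s i <;> simp [h]
  · intro h
    refine ⟨fun i => decide (y i = 1), funext fun i => ?_⟩
    rcases h i with h | h <;> norm_num [h]

lemma IsSign.neg {k : ℕ} {y : Fin k → ℝ} (hy : IsSign k y) : IsSign k (fun i => -y i) := by
  intro i
  rcases hy i with h | h <;> simp [h]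

lemma sum_signVecs_neg (k : ℕ) (g : (Fin k → ℝ) → ℝ) :
    ∑ y ∈ signVecs k, g (fun i => -y i) = ∑ y ∈ signVecs k, g y := by
  refine Finset.sum_bij' (fun y _ i => -y i) (fun y _ i => -y i) ?_ ?_ ?_ ?_ ?_
  · exact fun y hy => mem_signVecs.2 (mem_signVecs.1 hy).neg
  · exact fun y hy => mem_signVecs.2 (mem_signVecs.1 hy).neg
  all_goals simp

lemma misSet_neg {k : ℕ} {v y : Fin k → ℝ} (hv : IsV k v) (hy : IsSign k y) :
    misSet k v (fun i => -y i) = (misSet k v y \ absSet k v)ᶜ := by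
  ext i
  simp only [misSet, absSet, mem_filter, mem_univ, true_and, mem_compl, mem_sdiff]
  rcases hv i with h | h | h <;> rcases hy i with h' | h' <;> rw [h, h'] <;> norm_num

/-- Pairing each label with its negation in the expected loss under the uniform distribution. -/
lemma sum_abstain_eq {k : ℕ} (f : (Fin k → ℝ) → Finset (Fin k) → ℝ) {v : Fin k → ℝ}
    (hv : IsV k v) :
    ∑ y ∈ signVecs k, ((2:ℝ)^k)⁻¹ * (f y (misSet k v y \ absSet k v) + f y (misSet k v y)) =
      ∑ y ∈ signVecs k, ((2:ℝ)^k)⁻¹ * (f y (misSet k v y \ absSet k v) +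
        f (fun i => -y i) (misSet k v y \ absSet k v)ᶜ) := by
  simp only [← Finset.mul_sum, Finset.sum_add_distrib]
  rw [← sum_signVecs_neg k (fun y => f y (misSet k v y))]
  congr 2
  refine Finset.sum_congr rfl fun y hy => ?_
  rw [misSet_neg hv (mem_signVecs.1 hy)]

lemma abstain_zero {k : ℕ} {f : Finset (Fin k) → ℝ} (hf : IsPolymatroid k f) {y : Fin k → ℝ}
    (hy : IsSign k y) :
    f (misSet k (fun _ => 0) y \ absSet k (fun _ => 0)) + f (misSet k (fun _ => 0) y) =
      f univ := by
  have h : misSet k (fun _ => 0) y = univ := by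
    ext i
    rcases hy i with h | h <;> simp [misSet, h]
  have h' : absSet k (fun _ => 0) = univ := by simp [absSet]
  rw [h, h', Finset.sdiff_self, hf.1, zero_add]

lemma exists_ne_ne {k : ℕ} (hk : 3 ≤ k) (a b : Fin k) : ∃ c, c ≠ a ∧ c ≠ b := by
  obtain ⟨c, hc⟩ : (({a, b} : Finset (Fin k))ᶜ).Nonempty := by
    rw [← Finset.card_pos, Finset.card_compl, Fintype.card_fin]
    have := Finset.card_le_two (a := a) (b := b)
    omega
  exact ⟨c, by simpa using hc⟩

/-- A sign vector whose disagreement set is nonempty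
and proper and which avoids the exceptional labels of Condition 1. -/
lemma exists_sign_strict {k : ℕ} (hk : 3 ≤ k) {v : Fin k → ℝ} (hv : IsV k v)
    (h0 : v ≠ fun _ => 0) (h1 : v ≠ fun _ => 1) :
    ∃ y, IsSign k y ∧ misSet k v y \ absSet k v ≠ ∅ ∧ misSet k v y \ absSet k v ≠ univ ∧
      y ≠ (fun _ => -1) ∧ y ≠ (fun i => -(chiS k (misSet k v y \ absSet k v) i)) ∧
      y ≠ (fun _ => 1) := by
  have hmem : ∀ y i, i ∈ misSet k v y \ absSet k v ↔ v i ≠ y i ∧ v i ≠ 0 := by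
    simp [misSet, absSet]
  suffices H : ∃ y, IsSign k y ∧ (∃ l, v l ≠ y l ∧ v l ≠ 0) ∧ (∃ j, ¬(v j ≠ y j ∧ v j ≠ 0)) ∧
      (∃ i, y i = 1) ∧ (∃ i, y i = -1) ∧
      ∃ i, (v i ≠ y i ∧ v i ≠ 0 ∧ y i = 1) ∨ (¬(v i ≠ y i ∧ v i ≠ 0) ∧ y i = -1) by
    obtain ⟨y, hy, ⟨l, hl⟩, ⟨j, hj⟩, ⟨a, ha⟩, ⟨b, hb⟩, ⟨c, hc⟩⟩ := H
    refine ⟨y, hy, ?_, ?_, ?_, ?_, ?_⟩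
    · exact Finset.ne_empty_of_mem ((hmem y l).2 hl)
    · exact fun h => hj ((hmem y j).1 (h ▸ mem_univ j))
    · intro h
      have := congrFun h a
      norm_num [ha] at this
    · intro h
      have h' := congrFun h c
      simp only [chiS, hmem] at h'
      rcases hc with ⟨hc1, hc2, hc3⟩ | ⟨hc1, hc2⟩
      · rw [if_pos ⟨hc1, hc2⟩, hc3] at h'
        norm_num at h'
      · rw [if_neg hc1, hc2] at h'
        norm_num at h'
    · intro h
      have := congrFun h b
      norm_num [hb] at this
  by_cases hz : ∃ j, v j = 0
  · obtain ⟨j, hj⟩ := hz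
    obtain ⟨l, hl⟩ := Function.ne_iff.1 h0
    have hlj : l ≠ j := by rintro rfl; exact hl hj
    obtain ⟨m, hml, hmj⟩ := exists_ne_ne hk l j
    refine ⟨fun i => if i = l then -v l else if i = j then -1 else 1, ?_, ⟨l, ?_⟩, ⟨j, ?_⟩,
      ⟨m, ?_⟩, ⟨j, ?_⟩, ⟨j, Or.inr ?_⟩⟩
    · intro i
      dsimp only
      split_ifs
      · rcases hv l with h | h | h
        · simp [h]
        · exact absurd h hl
        · simp [h]
      · simp
      · simp
    · refine ⟨fun h => hl ?_, hl⟩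
      simp only [if_true] at h
      linarith
    · simp [hj]
    · simp [hml, hmj]
    · simp [hlj.symm]
    · simp [hj, hlj.symm]
  · push Not at hz
    obtain ⟨l, hl⟩ := Function.ne_iff.1 h1
    have hl : v l = -1 := by
      rcases hv l with h | h | h
      · exact h
      · exact absurd h (hz l)
      · exact absurd h hl
    obtain ⟨m, hml, -⟩ := exists_ne_ne hk l l
    obtain ⟨n, hnl, hnm⟩ := exists_ne_ne hk l m
    refine ⟨fun i => if i = l then 1 else if i = m then -1 else v i, ?_, ⟨l, ?_⟩, ⟨n, ?_⟩,
      ⟨l, ?_⟩, ⟨m, ?_⟩, ⟨l, Or.inl ?_⟩⟩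
    · intro i
      dsimp only
      split_ifs
      · simp
      · simp
      · rcases hv i with h | h | h
        · exact Or.inr h
        · exact absurd h (hz i)
        · exact Or.inl h
    · norm_num [hl]
    · simp [hnl, hnm]
    · simp
    · simp [hml]
    · norm_num [hl]

/-- Under Condition 1 and `k ≥ 3`, the all-zeros vector minimizes the
expected structured abstain loss under the uniform distribution over `{-1,0,1}^k`, and every
minimizer is `0⃗` or `1⃗`. -/
theorem zero_optimal_uniform (k : ℕ) (hk : 3 ≤ k)
    (f : (Fin k → ℝ) → Finset (Fin k) → ℝ)
    (hf : ∀ y : Fin k → ℝ, IsSign k y → IsPolymatroid k (f y))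
    (hcond : Condition1 k f) :
    (∀ v : Fin k → ℝ, IsV k v →
      ∑ y ∈ signVecs k, ((2:ℝ)^k)⁻¹ *
          (f y (misSet k (fun _ => 0) y \ absSet k (fun _ => 0))
            + f y (misSet k (fun _ => 0) y))
        ≤ ∑ y ∈ signVecs k, ((2:ℝ)^k)⁻¹ *
          (f y (misSet k v y \ absSet k v) + f y (misSet k v y))) ∧
    (∀ v : Fin k → ℝ, IsV k v →
      (∀ v' : Fin k → ℝ, IsV k v' →
        ∑ y ∈ signVecs k, ((2:ℝ)^k)⁻¹ *
            (f y (misSet k v y \ absSet k v) + f y (misSet k v y))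
          ≤ ∑ y ∈ signVecs k, ((2:ℝ)^k)⁻¹ *
            (f y (misSet k v' y \ absSet k v') + f y (misSet k v' y))) →
      v = (fun _ => (0:ℝ)) ∨ v = (fun _ => (1:ℝ))) := by
  have hpos : (0:ℝ) < ((2:ℝ)^k)⁻¹ := by positivity
  have hzero : ∑ y ∈ signVecs k, ((2:ℝ)^k)⁻¹ *
      (f y (misSet k (fun _ => 0) y \ absSet k (fun _ => 0)) + f y (misSet k (fun _ => 0) y)) =
      ∑ y ∈ signVecs k, ((2:ℝ)^k)⁻¹ * f y univ :=
    Finset.sum_congr rfl fun y hy => by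
      have hy := mem_signVecs.1 hy
      rw [abstain_zero (hf y hy) hy]
  refine ⟨fun v hv => ?_, fun v hv hmin => ?_⟩
  · rw [hzero, sum_abstain_eq f hv]
    exact Finset.sum_le_sum fun y hy =>
      mul_le_mul_of_nonneg_left (((hcond y (mem_signVecs.1 hy)).2 _).1) hpos.le
  · by_contra! hne
    obtain ⟨y₀, hy₀, hS, hS', hy1, hy2, hy3⟩ := exists_sign_strict hk hv hne.1 hne.2
    have hle := hmin (fun _ => 0) fun _ => Or.inr (Or.inl rfl)
    rw [hzero, sum_abstain_eq f hv] at hle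
    refine absurd hle (not_le.2 (Finset.sum_lt_sum ?_ ⟨y₀, mem_signVecs.2 hy₀, ?_⟩))
    · exact fun y hy =>
        mul_le_mul_of_nonneg_left (((hcond y (mem_signVecs.1 hy)).2 _).1) hpos.le
    · exact mul_lt_mul_of_pos_left (((hcond y₀ hy₀).2 _).2 hS hS' hy1 hy2 hy3) hpos

end
end
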